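/- arXiv:1904.07489 — 2 statements merged into one kernel-verified Lean document; each statement's English description precedes it below -/
import Mathlib

section
/- Let (X,d) be a metric space, let u, v belong to F_usc^1(X), and let t ∈ T. Then H_end(u, v) ≤ d_∞(tv, u) + D(t); in particular, H_end(u,v) ≤ 2 d_0(u,v). -/
open Set Filter Topology EMetric ENNReal

variable {X : Type*} [MetricSpace X]

/-- The α-cut of a fuzzy set `u`; the 0-cut is the support. -/
noncomputable def cut (u : X → ℝ) (α : ℝ) : Set X :=
  if α = 0 then closure {x | 0 < u x} else {x | α ≤ u x}

/-- `u` is a normal, upper semi-continuous fuzzy set on `X` (member of F_usc^1(X)). -/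
def FuzzyUSC (u : X → ℝ) : Prop :=
  (∀ x, u x ∈ Icc (0:ℝ) 1) ∧ ({x | 1 ≤ u x}).Nonempty ∧
    ∀ α ∈ Icc (0:ℝ) 1, IsClosed (cut u α)

/-- `t ∈ T`: strictly increasing continuous map of [0,1] onto [0,1]. -/
def IsTimeChange (t : ℝ → ℝ) : Prop :=
  ContinuousOn t (Icc 0 1) ∧ StrictMonoOn t (Icc 0 1) ∧ t '' Icc 0 1 = Icc 0 1

/-- D(t) = sup_{α ∈ [0,1]} |t(α) − α|. -/
noncomputable def Dt (t : ℝ → ℝ) : ℝ≥0∞ :=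
  ⨆ α ∈ Icc (0:ℝ) 1, edist (t α) α

/-- Supremum metric d∞(u,v) = sup_{α ∈ [0,1]} H([u]_α, [v]_α). -/
noncomputable def dInfty (u v : X → ℝ) : ℝ≥0∞ :=
  ⨆ α ∈ Icc (0:ℝ) 1, hausdorffEdist (cut u α) (cut v α)

/-- Skorokhod metric d₀. -/
noncomputable def dSkor (u v : X → ℝ) : ℝ≥0∞ :=
  sInf {ε | ∃ t, IsTimeChange t ∧ Dt t ≤ ε ∧ dInfty u (fun x => t (v x)) ≤ ε}

/-- Endograph of a fuzzy set. -/
def endo (u : X → ℝ) : Set (X × ℝ) := {p | p.2 ∈ Icc (0:ℝ) 1 ∧ p.2 ≤ u p.1}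

/-- Endograph metric H_end(u,v). -/
noncomputable def Hend (u v : X → ℝ) : ℝ≥0∞ :=
  hausdorffEdist (endo u) (endo v)


theorem infEdist_prod_le_max {Y : Type*} [PseudoEMetricSpace Y] {Z : Type*}
    [PseudoEMetricSpace Z] {x : Y} {a b : Z} {S : Set Y} {E : Set (Y × Z)}
    (hE : ∀ y ∈ S, (y, b) ∈ E) :
    Metric.infEDist (x, a) E ≤ max (Metric.infEDist x S) (edist a b) := by
  refine le_of_forall_gt fun r hr => ?_
  obtain ⟨hS, hab⟩ := max_lt_iff.1 hr
  obtain ⟨y, hy, hxy⟩ := Metric.infEDist_lt_iff.1 hS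
  exact Metric.infEDist_lt_iff.2 ⟨(y, b), hE y hy, max_lt hxy hab⟩

theorem edist_le_Dt (t : ℝ → ℝ) {α : ℝ} (hα : α ∈ Icc (0:ℝ) 1) : edist (t α) α ≤ Dt t :=
  le_iSup₂ (f := fun α (_ : α ∈ Icc (0:ℝ) 1) => edist (t α) α) α hα

theorem hausdorffEDist_cut_le_dInfty {Y : Type*} [MetricSpace Y] (u v : Y → ℝ) {α : ℝ}
    (hα : α ∈ Icc (0:ℝ) 1) : Metric.hausdorffEDist (cut u α) (cut v α) ≤ dInfty u v :=
  le_iSup₂ (f := fun α (_ : α ∈ Icc (0:ℝ) 1) => Metric.hausdorffEDist (cut u α) (cut v α)) α hα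

theorem dInfty_comm {Y : Type*} [MetricSpace Y] (u v : Y → ℝ) : dInfty u v = dInfty v u :=
  iSup_congr fun _ => iSup_congr fun _ => Metric.hausdorffEDist_comm

theorem mem_cut_of_pos {Y : Type*} [MetricSpace Y] {u : Y → ℝ} {α : ℝ} (hα : 0 < α) {x : Y} :
    x ∈ cut u α ↔ α ≤ u x := by
  simp [cut, hα.ne']

theorem Hend_le_dInfty_add_Dt {Y : Type*} [MetricSpace Y] {u v : Y → ℝ} {t : ℝ → ℝ}
    (hu : ∀ x, u x ∈ Icc (0:ℝ) 1) (hv : ∀ x, v x ∈ Icc (0:ℝ) 1) (ht : IsTimeChange t) :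
    Hend u v ≤ dInfty (fun x => t (v x)) u + Dt t := by
  obtain ⟨-, hmono, himg⟩ := ht
  have hmaps : ∀ a ∈ Icc (0:ℝ) 1, t a ∈ Icc (0:ℝ) 1 := fun a ha => himg ▸ mem_image_of_mem t ha
  refine Metric.hausdorffEDist_le_of_infEDist ?_ ?_
  · rintro ⟨x, α⟩ ⟨hα, hx⟩
    rcases hα.1.eq_or_lt with rfl | hpos
    · exact (Metric.infEDist_zero_of_mem (s := endo v) ⟨hα, (hv x).1⟩).trans_le zero_le
    obtain ⟨β, hβ, rfl⟩ : α ∈ t '' Icc 0 1 := himg.symm.subset hα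
    refine (infEdist_prod_le_max (E := endo v) (S := cut (fun x => t (v x)) (t β)) (b := β) fun y hy =>
      ⟨hβ, (hmono.le_iff_le hβ (hv y)).1 ((mem_cut_of_pos (u := fun x => t (v x)) hpos).1 hy)⟩).trans
      ((max_le_add_of_nonneg zero_le zero_le).trans (add_le_add ?_ (edist_le_Dt t hβ)))
    rw [dInfty_comm]
    exact (Metric.infEDist_le_hausdorffEDist_of_mem ((mem_cut_of_pos hpos).2 hx)).trans
      (hausdorffEDist_cut_le_dInfty _ _ hα)
  · rintro ⟨x, α⟩ ⟨hα, hx⟩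
    rcases hα.1.eq_or_lt with rfl | hpos
    · exact (Metric.infEDist_zero_of_mem (s := endo u) ⟨hα, (hu x).1⟩).trans_le zero_le
    have h0 : (0:ℝ) ∈ Icc (0:ℝ) 1 := left_mem_Icc.2 zero_le_one
    have htpos : 0 < t α := (hmaps 0 h0).1.trans_lt (hmono h0 hα hpos)
    refine (infEdist_prod_le_max (E := endo u) (S := cut u (t α)) (b := t α) fun y hy =>
      ⟨hmaps α hα, (mem_cut_of_pos htpos).1 hy⟩).trans
      ((max_le_add_of_nonneg zero_le zero_le).trans
        (add_le_add ?_ ((edist_comm _ _).trans_le (edist_le_Dt t hα))))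
    have hxt : x ∈ cut (fun x => t (v x)) (t α) :=
      (mem_cut_of_pos htpos).2 ((hmono.le_iff_le hα (hv x)).2 hx)
    exact (Metric.infEDist_le_hausdorffEDist_of_mem hxt).trans
      (hausdorffEDist_cut_le_dInfty _ _ (hmaps α hα))

theorem stmt6 {X : Type*} [MetricSpace X] (u v : X → ℝ) (t : ℝ → ℝ)
    (hu : FuzzyUSC u) (hv : FuzzyUSC v) (ht : IsTimeChange t) :
    Hend u v ≤ dInfty (fun x => t (v x)) u + Dt t ∧ Hend u v ≤ 2 * dSkor u v := by
  refine ⟨Hend_le_dInfty_add_Dt hu.1 hv.1 ht, ?_⟩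
  rw [← ENNReal.div_le_iff' two_ne_zero ofNat_ne_top]
  refine le_sInf ?_
  rintro ε ⟨s, hs, hD, hd⟩
  rw [ENNReal.div_le_iff' two_ne_zero ofNat_ne_top, two_mul]
  refine (Hend_le_dInfty_add_Dt hu.1 hv.1 hs).trans (add_le_add ?_ hD)
  rwa [dInfty_comm]
end

section
/- Let u_0 : ℝ → [0,1] be defined by u_0(x) = 1 if x = 0, u_0(x) = 1/2 if x ∈ (0,2], and u_0(x) = 0 otherwise; and for n ≥ 1 let u_n : ℝ → [0,1] be defined by u_n(x) = 1 − (1/2)x^{1/n} for x ∈ [0,1], u_n(x) = (1/2)(1 − (x−1)^n) for x ∈ [1,2], and u_n(x) = 0 otherwise. Then H_end(u_n, u_0) → 0 as n → ∞, i.e. the endographs of u_n converge to the endograph of u_0 in the Hausdorff metric on subsets of ℝ × [0,1]. -/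
open Set Filter Topology EMetric ENNReal

variable {X : Type*} [MetricSpace X]

/-- The fuzzy set u₀ of the example. -/
noncomputable def uZero : ℝ → ℝ := fun x =>
  if x = 0 then 1 else if x ∈ Ioc (0:ℝ) 2 then 1/2 else 0

/-- The fuzzy sets uₙ of the example. -/
noncomputable def uSeq (n : ℕ) : ℝ → ℝ := fun x =>
  if x ∈ Icc (0:ℝ) 1 then 1 - (1/2) * x ^ ((1:ℝ)/(n:ℝ))
  else if x ∈ Icc (1:ℝ) 2 then (1/2) * (1 - (x-1)^n) else 0

lemma one_sub_le_rpow_inv {n : ℕ} {ε x : ℝ} (hn : n ≠ 0) (hε : ε ≤ 1)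
    (h : (1 - ε) ^ n ≤ x) : 1 - ε ≤ x ^ ((1 : ℝ) / n) := by
  have h1 : 0 ≤ 1 - ε := by linarith
  rw [one_div]
  calc 1 - ε = ((1 - ε) ^ n) ^ ((n : ℝ)⁻¹) := (Real.pow_rpow_inv_natCast h1 hn).symm
    _ ≤ x ^ ((n : ℝ)⁻¹) := Real.rpow_le_rpow (pow_nonneg h1 n) h (by positivity)

lemma uZero_zero : uZero 0 = 1 := by simp [uZero]

lemma uZero_of_mem {x : ℝ} (hx : x ∈ Ioc (0 : ℝ) 2) : uZero x = 1 / 2 := by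
  simp only [uZero, if_neg hx.1.ne', if_pos hx]

lemma uZero_nonneg (x : ℝ) : 0 ≤ uZero x := by
  unfold uZero
  split_ifs <;> norm_num

lemma uSeq_of_mem_Icc {x : ℝ} (n : ℕ) (hx : x ∈ Icc (0 : ℝ) 1) :
    uSeq n x = 1 - 1 / 2 * x ^ ((1 : ℝ) / n) := if_pos hx

lemma uSeq_of_mem_Ioc {x : ℝ} (n : ℕ) (hx : x ∈ Ioc (1 : ℝ) 2) :
    uSeq n x = 1 / 2 * (1 - (x - 1) ^ n) := by
  rw [uSeq, if_neg fun h => h.2.not_gt hx.1, if_pos (Ioc_subset_Icc_self hx)]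

lemma uSeq_of_notMem {x : ℝ} (n : ℕ) (hx : x ∉ Icc (0 : ℝ) 2) : uSeq n x = 0 := by
  rw [uSeq, if_neg fun h => hx ⟨h.1, h.2.trans one_le_two⟩,
    if_neg fun h => hx ⟨zero_le_one.trans h.1, h.2⟩]

lemma half_le_uSeq {x : ℝ} (n : ℕ) (hx : x ∈ Icc (0 : ℝ) 1) : 1 / 2 ≤ uSeq n x := by
  rw [uSeq_of_mem_Icc n hx]
  have : x ^ ((1 : ℝ) / n) ≤ 1 := Real.rpow_le_one hx.1 hx.2 (by positivity)
  linarith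

lemma uSeq_nonneg (n : ℕ) (x : ℝ) : 0 ≤ uSeq n x := by
  by_cases h : x ∈ Icc (0 : ℝ) 2
  · rcases le_or_gt x 1 with h1 | h1
    · linarith [half_le_uSeq n ⟨h.1, h1⟩]
    · rw [uSeq_of_mem_Ioc n ⟨h1, h.2⟩]
      have : (x - 1) ^ n ≤ 1 := pow_le_one₀ (by linarith) (by linarith [h.2])
      linarith
  · exact (uSeq_of_notMem n h).ge

lemma uSeq_zero {n : ℕ} (hn : n ≠ 0) : uSeq n 0 = 1 := by
  rw [uSeq_of_mem_Icc n ⟨le_rfl, zero_le_one⟩, Real.zero_rpow (by positivity)]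
  norm_num

lemma uSeq_le {n : ℕ} {ε x : ℝ} (hn : n ≠ 0) (hε₀ : 0 < ε) (hε : ε ≤ 1) (h : (1 - ε) ^ n ≤ ε)
    (hx : ε ≤ x) : uSeq n x ≤ 1 / 2 + ε := by
  by_cases h2 : x ∈ Icc (0 : ℝ) 2
  · rcases le_or_gt x 1 with h1 | h1
    · rw [uSeq_of_mem_Icc n ⟨h2.1, h1⟩]
      linarith [one_sub_le_rpow_inv hn hε (h.trans hx)]
    · rw [uSeq_of_mem_Ioc n ⟨h1, h2.2⟩]
      have : 0 ≤ (x - 1) ^ n := pow_nonneg (by linarith) n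
      linarith
  · rw [uSeq_of_notMem n h2]
    linarith

lemma le_uSeq {n : ℕ} {ε x : ℝ} (hε₀ : 0 < ε) (h : (1 - ε) ^ n ≤ ε)
    (hx : 1 < x) (hx2 : x ≤ 2 - ε) : 1 / 2 - ε ≤ uSeq n x := by
  rw [uSeq_of_mem_Ioc n ⟨hx, by linarith⟩]
  have : (x - 1) ^ n ≤ (1 - ε) ^ n := pow_le_pow_left₀ (by linarith) (by linarith) n
  linarith

lemma exists_mem_endo_uZero {n : ℕ} {ε : ℝ} (hn : n ≠ 0) (hε₀ : 0 < ε) (hε : ε ≤ 1)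
    (h : (1 - ε) ^ n ≤ ε) {p : ℝ × ℝ} (hp : p ∈ endo (uSeq n)) :
    ∃ q ∈ endo uZero, dist p q ≤ ε := by
  obtain ⟨x, a⟩ := p
  obtain ⟨⟨ha0, ha1⟩, ha⟩ := hp
  dsimp only at ha0 ha1 ha
  by_cases h2 : x ∈ Icc (0 : ℝ) 2
  · rcases lt_or_ge x ε with hx | hx
    · refine ⟨(0, a), ⟨⟨ha0, ha1⟩, by rwa [uZero_zero]⟩, ?_⟩
      simpa [Prod.dist_eq, abs_of_nonneg h2.1, hε₀.le] using hx.le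
    · have hu := ha.trans (uSeq_le hn hε₀ hε h hx)
      refine ⟨(x, min a (1 / 2)), ⟨⟨le_min ha0 (by norm_num), (min_le_left _ _).trans ha1⟩, ?_⟩, ?_⟩
      · rw [uZero_of_mem ⟨hε₀.trans_le hx, h2.2⟩]
        exact min_le_right _ _
      · rw [Prod.dist_eq, dist_self, Real.dist_eq]
        refine max_le hε₀.le (abs_le.2 ⟨?_, ?_⟩)
        · linarith [min_le_left a (1 / 2)]
        · rcases min_choice a (1 / 2) with hm | hm <;> rw [hm] <;> linarith
  · rw [uSeq_of_notMem n h2] at ha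
    exact ⟨(x, a), ⟨⟨ha0, ha1⟩, ha.trans (uZero_nonneg x)⟩, by simpa using hε₀.le⟩

lemma exists_mem_endo_uSeq {n : ℕ} {ε : ℝ} (hn : n ≠ 0) (hε₀ : 0 < ε)
    (h : (1 - ε) ^ n ≤ ε) {p : ℝ × ℝ} (hp : p ∈ endo uZero) :
    ∃ q ∈ endo (uSeq n), dist p q ≤ ε := by
  obtain ⟨x, a⟩ := p
  obtain ⟨⟨ha0, ha1⟩, ha⟩ := hp
  dsimp only at ha0 ha1 ha
  by_cases hx : a ≤ uSeq n x
  · exact ⟨(x, a), ⟨⟨ha0, ha1⟩, hx⟩, by simpa using hε₀.le⟩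
  have hx0 : x ≠ 0 := by
    rintro rfl
    exact hx (ha1.trans (uSeq_zero hn).ge)
  have hx2 : x ∈ Ioc (0 : ℝ) 2 := by
    by_contra hx2
    rw [uZero, if_neg hx0, if_neg hx2] at ha
    exact hx (ha.trans (uSeq_nonneg n x))
  rw [uZero_of_mem hx2] at ha
  have hx1 : 1 < x := by
    by_contra! hx1
    exact hx (ha.trans (half_le_uSeq n ⟨hx2.1.le, hx1⟩))
  rcases le_or_gt x (1 + ε) with hxε | hxε
  · refine ⟨(1, a), ⟨⟨ha0, ha1⟩, ha.trans (half_le_uSeq n ⟨zero_le_one, le_rfl⟩)⟩, ?_⟩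
    rw [Prod.dist_eq, dist_self, Real.dist_eq]
    exact max_le (abs_le.2 ⟨by linarith, by linarith⟩) hε₀.le
  · have hu := le_uSeq (x := x - ε) hε₀ h (by linarith) (by linarith [hx2.2])
    refine ⟨(x - ε, max (a - ε) 0), ⟨⟨le_max_right _ _, max_le (by linarith) zero_le_one⟩,
      max_le (by linarith) (uSeq_nonneg n _)⟩, ?_⟩
    rw [Prod.dist_eq, Real.dist_eq, Real.dist_eq]
    refine max_le (abs_le.2 ⟨by linarith, by linarith⟩) (abs_le.2 ⟨?_, ?_⟩)
    · rcases max_choice (a - ε) 0 with hm | hm <;> rw [hm] <;> linarith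
    · linarith [le_max_left (a - ε) 0]

lemma Hend_uSeq_uZero_le {n : ℕ} {ε : ℝ} (hn : n ≠ 0) (hε₀ : 0 < ε) (hε : ε ≤ 1)
    (h : (1 - ε) ^ n ≤ ε) : Hend (uSeq n) uZero ≤ ENNReal.ofReal ε := by
  refine Metric.hausdorffEDist_le_of_mem_edist (fun p hp => ?_) fun p hp => ?_
  · obtain ⟨q, hq, hd⟩ := exists_mem_endo_uZero hn hε₀ hε h hp
    exact ⟨q, hq, by rw [edist_dist]; exact ENNReal.ofReal_le_ofReal hd⟩
  · obtain ⟨q, hq, hd⟩ := exists_mem_endo_uSeq hn hε₀ h hp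
    exact ⟨q, hq, by rw [edist_dist]; exact ENNReal.ofReal_le_ofReal hd⟩

theorem stmt11 :
    Tendsto (fun n => Hend (uSeq n) uZero) atTop (𝓝 0) := by
  rw [ENNReal.tendsto_nhds_zero]
  intro δ hδ
  obtain ⟨r, hr0, hr⟩ := ENNReal.lt_iff_exists_nnreal_btwn.1 hδ
  have hr0' : (0 : ℝ) < r := by exact_mod_cast hr0
  set ε : ℝ := min r 1
  have hε₀ : 0 < ε := lt_min hr0' one_pos
  have hε : ε ≤ 1 := min_le_right _ _
  have hpow : Tendsto (fun n : ℕ => (1 - ε) ^ n) atTop (𝓝 0) :=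
    tendsto_pow_atTop_nhds_zero_of_lt_one (by linarith) (by linarith)
  filter_upwards [hpow.eventually_le_const hε₀, eventually_ne_atTop 0] with n hn hn0
  calc Hend (uSeq n) uZero ≤ ENNReal.ofReal ε := Hend_uSeq_uZero_le hn0 hε₀ hε hn
    _ ≤ ENNReal.ofReal r := ENNReal.ofReal_le_ofReal (min_le_left _ _)
    _ = r := ENNReal.ofReal_coe_nnreal
    _ ≤ δ := hr.le
end
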